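/- Let v₁ = (a, c) and v₂ = (b, d) be primitive, linearly independent vectors in ℤ². Then there exist a unique positive integer ι and a unique primitive vector u ∈ ℤ² such that ⟨u, v₁⟩ = ⟨u, v₂⟩ = ι; moreover this ι is given by ι = |ad − bc| / gcd(c − d, b − a). -/

import Mathlib

/-- By Cramer's rule, a vector pairing to `ι` with both `(a, c)` and `(b, d)` is proportional to
`(d - c, a - b)`. -/
lemma det_mul_eq_of_pairing_eq {a b c d x y ι : ℤ} (h₁ : x * a + y * c = ι)
    (h₂ : x * b + y * d = ι) :
    (a * d - b * c) * x = ι * (d - c) ∧ (a * d - b * c) * y = ι * (a - b) :=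
  ⟨by linear_combination d * h₁ - c * h₂, by linear_combination a * h₂ - b * h₁⟩

/-- If a primitive vector pairs to `ι > 0` with both `(a, c)` and `(b, d)`, then
`ι * gcd (c - d) (b - a)` is the absolute value of the determinant. -/
lemma mul_gcd_eq_abs_det_of_pairing_eq {a b c d x y ι : ℤ} (hι : 0 < ι) (hxy : Int.gcd x y = 1)
    (h₁ : x * a + y * c = ι) (h₂ : x * b + y * d = ι) :
    ι * (Int.gcd (c - d) (b - a) : ℤ) = |a * d - b * c| := by
  obtain ⟨hx, hy⟩ := det_mul_eq_of_pairing_eq h₁ h₂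
  have hgcd : Int.gcd ((a * d - b * c) * x) ((a * d - b * c) * y) =
      Int.gcd (ι * (d - c)) (ι * (a - b)) := by rw [hx, hy]
  rw [Int.gcd_mul_left, Int.gcd_mul_left, hxy, mul_one, ← neg_sub c d, ← neg_sub b a,
    Int.gcd_neg, Int.neg_gcd] at hgcd
  rw [Int.abs_eq_natAbs, hgcd, Nat.cast_mul, Int.natAbs_of_nonneg hι.le]

/-- Two linearly independent vectors of `ℤ²` pair to a common positive integer with some
primitive vector. -/
lemma exists_primitive_pairing_eq {a b c d : ℤ} (hD : a * d - b * c ≠ 0) :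
    ∃ ι x y : ℤ, 0 < ι ∧ Int.gcd x y = 1 ∧ x * a + y * c = ι ∧ x * b + y * d = ι := by
  have hg : 0 < Int.gcd (d - c) (a - b) := by
    rw [Int.gcd_pos_iff]
    by_contra! h
    exact hD (by linear_combination a * h.1 + c * h.2)
  obtain ⟨x, y, hxy, hx, hy⟩ := Int.exists_gcd_one hg
  set g : ℤ := (Int.gcd (d - c) (a - b) : ℤ)
  have hg0 : g ≠ 0 := Int.natCast_ne_zero.mpr hg.ne'
  have he : x * b + y * d = x * a + y * c :=
    mul_right_cancel₀ hg0 (by linear_combination (a - b) * hx + (c - d) * hy)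
  have he0 : x * a + y * c ≠ 0 := fun h =>
    hD (by linear_combination a * hx + c * hy + g * h)
  rcases he0.lt_or_gt with h | h
  · exact ⟨-(x * a + y * c), -x, -y, by linarith, by rwa [Int.gcd_neg, Int.neg_gcd],
      by ring, by linear_combination -he⟩
  · exact ⟨x * a + y * c, x, y, h, hxy, rfl, he⟩

/-- Linearly independent vectors of `ℤ²` have nonzero determinant. -/
lemma det_ne_zero_of_linearIndependent_pair {v₁ v₂ : Fin 2 → ℤ}
    (hind : LinearIndependent ℤ ![v₁, v₂]) : v₁ 0 * v₂ 1 - v₂ 0 * v₁ 1 ≠ 0 := by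
  intro h
  obtain ⟨w, hw, hw0⟩ := Matrix.exists_vecMul_eq_zero_iff (M := Matrix.of ![v₁, v₂]) |>.mpr <| by
    simpa [Matrix.det_fin_two, mul_comm (v₁ 1)] using h
  refine hw (funext (Fintype.linearIndependent_iff.mp hind w ?_))
  rwa [Matrix.vecMul_eq_sum] at hw0

/-- For primitive, linearly independent `v₁ = (a, c)` and
`v₂ = (b, d)` in `ℤ²`, there exist a unique positive integer `ι` and a unique primitive
`u ∈ ℤ²` with `⟨u, v₁⟩ = ⟨u, v₂⟩ = ι`; moreover this `ι` equals
`|ad − bc| / gcd(c − d, b − a)`. -/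
theorem stmt_15 (v₁ v₂ : Fin 2 → ℤ)
    (h1 : Int.gcd (v₁ 0) (v₁ 1) = 1) (h2 : Int.gcd (v₂ 0) (v₂ 1) = 1)
    (hind : LinearIndependent ℤ ![v₁, v₂]) :
    (∃! p : ℤ × (Fin 2 → ℤ), 0 < p.1 ∧ Int.gcd (p.2 0) (p.2 1) = 1 ∧
      p.2 0 * v₁ 0 + p.2 1 * v₁ 1 = p.1 ∧ p.2 0 * v₂ 0 + p.2 1 * v₂ 1 = p.1) ∧
    (∀ (ι : ℤ) (u : Fin 2 → ℤ), 0 < ι → Int.gcd (u 0) (u 1) = 1 →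
      u 0 * v₁ 0 + u 1 * v₁ 1 = ι → u 0 * v₂ 0 + u 1 * v₂ 1 = ι →
      ι = |v₁ 0 * v₂ 1 - v₂ 0 * v₁ 1| /
        (Int.gcd (v₁ 1 - v₂ 1) (v₂ 0 - v₁ 0) : ℤ)) := by
  have hD := det_ne_zero_of_linearIndependent_pair hind
  have key : ∀ (ι : ℤ) (u : Fin 2 → ℤ), 0 < ι → Int.gcd (u 0) (u 1) = 1 →
      u 0 * v₁ 0 + u 1 * v₁ 1 = ι → u 0 * v₂ 0 + u 1 * v₂ 1 = ι →
      ι = |v₁ 0 * v₂ 1 - v₂ 0 * v₁ 1| / (Int.gcd (v₁ 1 - v₂ 1) (v₂ 0 - v₁ 0) : ℤ) := by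
    intro ι u hι hu hu₁ hu₂
    have h := mul_gcd_eq_abs_det_of_pairing_eq hι hu hu₁ hu₂
    refine (Int.ediv_eq_of_eq_mul_left (fun h0 => ?_) h.symm).symm
    rw [h0, mul_zero] at h
    exact hD (abs_eq_zero.mp h.symm)
  refine ⟨?_, key⟩
  obtain ⟨ι, x, y, hι, hxy, hu₁, hu₂⟩ := exists_primitive_pairing_eq hD
  refine ⟨(ι, ![x, y]), ⟨hι, hxy, hu₁, hu₂⟩, ?_⟩
  rintro ⟨κ, u⟩ ⟨hκ, hu, hκ₁, hκ₂⟩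
  obtain rfl : κ = ι := (key κ u hκ hu hκ₁ hκ₂).trans (key ι ![x, y] hι hxy hu₁ hu₂).symm
  obtain ⟨hx, hy⟩ := det_mul_eq_of_pairing_eq hu₁ hu₂
  obtain ⟨hx', hy'⟩ := det_mul_eq_of_pairing_eq hκ₁ hκ₂
  refine Prod.ext rfl (funext fun i => ?_)
  fin_cases i
  · exact mul_left_cancel₀ hD (hx'.trans hx.symm)
  · exact mul_left_cancel₀ hD (hy'.trans hy.symm)
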